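/- arXiv:2505.02960 — 3 statements merged into one kernel-verified Lean document; each statement's English description precedes it below -/
import Mathlib

section
/- Let 𝒫 be a partition of {1, …, n} and let x, y ∈ U(𝒫). Then the assignment γ ↦ (uwn_B(γ))_{B ∈ 𝒫} induces a well-defined bijection between the set of homotopy classes (relative to endpoints) of continuous paths from x to y taking values in U(𝒫) and ℤ^𝒫: two such paths are homotopic within U(𝒫) if and only if uwn_B agrees for every block B, and every tuple of integers is realized. In particular, a loop γ in U(𝒫) is null-homotopic in U(𝒫) if and only if w_B(γ) = 0 for every block B ∈ 𝒫. -/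
/-- Determinant of the `B × B` submatrix of `M`. -/
noncomputable def blockDet {n : ℕ} (B : Finset (Fin n)) (M : Matrix (Fin n) (Fin n) ℂ) : ℂ :=
  (M.submatrix (fun i : {x // x ∈ B} => i.1) (fun j : {x // x ∈ B} => j.1)).det

/-- `B` is a block (equivalence class) of the relation `r`. -/
def IsBlock {n : ℕ} (r : Fin n → Fin n → Prop) (B : Finset (Fin n)) : Prop :=
  ∃ i, ∀ j, j ∈ B ↔ r i j

/-- The set `U(𝒫)` of unitary matrices that are block diagonal for the relation `r`. -/
def blockUnitary {n : ℕ} (r : Fin n → Fin n → Prop) : Set (Matrix (Fin n) (Fin n) ℂ) :=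
  {M | M ∈ Matrix.unitaryGroup (Fin n) ℂ ∧ ∀ i j, ¬ r i j → M i j = 0}

/-- `l` is a continuous lift of `f : I → ℂ` through `x ↦ exp (2 π i x)`. -/
def IsLift (f : unitInterval → ℂ) (l : unitInterval → ℝ) : Prop :=
  Continuous l ∧ ∀ t, f t = Complex.exp (2 * Real.pi * Complex.I * l t)

open Polynomial in
/-- `M` is joined to the identity by a polynomial path of matrices of determinant one. -/
def Matrix.IsPolyContractible {A m : Type*} [CommRing A] [Fintype m] [DecidableEq m]
    (M : Matrix m m A) : Prop :=
  ∃ H : Matrix m m A[X], H.det = 1 ∧ H.map (eval 0) = 1 ∧ H.map (eval 1) = M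

namespace Matrix.IsPolyContractible

open Polynomial

variable {A m p : Type*} [CommRing A] [Fintype m] [DecidableEq m] [Fintype p] [DecidableEq p]

theorem one : IsPolyContractible (1 : Matrix m m A) :=
  ⟨1, det_one, by simp, by simp⟩

theorem mul {M N : Matrix m m A} (hM : IsPolyContractible M) (hN : IsPolyContractible N) :
    IsPolyContractible (M * N) := by
  obtain ⟨H, hH, hH0, hH1⟩ := hM
  obtain ⟨K, hK, hK0, hK1⟩ := hN
  have h (a : A) : (H * K).map (eval a) = H.map (eval a) * K.map (eval a) :=
    Matrix.map_mul (f := evalRingHom a)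
  exact ⟨H * K, by rw [det_mul, hH, hK, one_mul], by rw [h, hH0, hK0, one_mul],
    by rw [h, hH1, hK1]⟩

theorem lower (c : Matrix p m A) : IsPolyContractible (fromBlocks 1 0 c 1) :=
  ⟨fromBlocks 1 0 (c.map fun a => C a * X) 1, by simp,
    by simp [fromBlocks_map, ← fromBlocks_one, Matrix.map_map, Function.comp_def]; rfl,
    by simp [fromBlocks_map, Matrix.map_map, Function.comp_def]⟩

theorem upper (r : Matrix m p A) : IsPolyContractible (fromBlocks 1 r 0 1) :=
  ⟨fromBlocks 1 (r.map fun a => C a * X) 0 1, by simp,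
    by simp [fromBlocks_map, ← fromBlocks_one, Matrix.map_map, Function.comp_def]; rfl,
    by simp [fromBlocks_map, Matrix.map_map, Function.comp_def]⟩

theorem one_fromBlocks {P : Matrix p p A} (hP : IsPolyContractible P) :
    IsPolyContractible (fromBlocks (1 : Matrix m m A) 0 0 P) := by
  obtain ⟨H, hH, hH0, hH1⟩ := hP
  exact ⟨fromBlocks 1 0 0 H, by simp [hH], by simp [fromBlocks_map, hH0],
    by simp [fromBlocks_map, hH1]⟩

theorem reindex {M : Matrix m m A} (hM : IsPolyContractible M) (e : m ≃ p) :
    IsPolyContractible (Matrix.reindex e e M) := by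
  obtain ⟨H, hH, hH0, hH1⟩ := hM
  refine ⟨Matrix.reindex e e H, by rw [det_reindex_self, hH], ?_, ?_⟩
  · simp [← submatrix_map, hH0]
  · simp [← submatrix_map, hH1]

theorem of_lower_mul (c : Matrix p m A) {M : Matrix (m ⊕ p) (m ⊕ p) A}
    (h : IsPolyContractible (fromBlocks 1 0 c 1 * M)) : IsPolyContractible M := by
  simpa [← Matrix.mul_assoc, fromBlocks_multiply] using (lower (-c)).mul h

theorem of_upper_mul (r : Matrix m p A) {M : Matrix (m ⊕ p) (m ⊕ p) A}
    (h : IsPolyContractible (fromBlocks 1 r 0 1 * M)) : IsPolyContractible M := by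
  simpa [← Matrix.mul_assoc, fromBlocks_multiply] using (upper (-r)).mul h

/-- If the corner of `M` is the identity, clearing its row and column reduces to a smaller matrix. -/
theorem of_corner_one
    (ih : ∀ P : Matrix p p A, P.det = 1 → IsPolyContractible P)
    (r : Matrix m p A) (c : Matrix p m A) (P : Matrix p p A)
    (h : (fromBlocks 1 r c P).det = 1) : IsPolyContractible (fromBlocks 1 r c P) := by
  have key : fromBlocks 1 r c P =
      fromBlocks 1 0 c 1 * fromBlocks 1 0 0 (P - c * r) * fromBlocks 1 r 0 1 := by
    simp [fromBlocks_multiply]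
  rw [key]
  refine ((lower c).mul (one_fromBlocks (ih _ ?_))).mul (upper r)
  rw [key] at h
  simpa using h

/-- Over a commutative ring of stable rank one every matrix of determinant one is polynomially
contractible. -/
theorem of_det_eq_one (hA : ∀ a b : A, IsCoprime a b → ∃ f, IsUnit (a + f * b))
    (M : Matrix m m A) (hM : M.det = 1) : IsPolyContractible M := by
  revert M
  suffices ∀ (k : ℕ) (M : Matrix (Fin k) (Fin k) A), M.det = 1 → IsPolyContractible M by
    intro M hM
    let e := Fintype.equivFin m
    simpa using (this _ (Matrix.reindex e e M) (by rwa [det_reindex_self])).reindex e.symm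
  intro k
  induction k with
  | zero => exact fun M _ => by rw [Subsingleton.elim M 1]; exact one
  | succ k ih =>
    suffices ∀ M : Matrix (Unit ⊕ Fin k) (Unit ⊕ Fin k) A, M.det = 1 → IsPolyContractible M by
      intro M hM
      let e : Fin (k + 1) ≃ Unit ⊕ Fin k := Fintype.equivOfCardEq (by simp [add_comm])
      simpa using (this (Matrix.reindex e e M) (by rwa [det_reindex_self])).reindex e.symm
    intro M hM
    obtain rfl | hk := Nat.eq_zero_or_pos k
    · have : M = 1 := by
        let _ : Unique (Unit ⊕ Fin 0) := (Equiv.sumEmpty Unit (Fin 0)).unique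
        ext i j
        rw [det_unique] at hM
        rw [Subsingleton.elim i default, Subsingleton.elim j default, hM, one_apply_eq]
      exact this ▸ one
    obtain ⟨a, r, c, P, rfl⟩ : ∃ a r c P, M = fromBlocks a r c P :=
      ⟨_, _, _, _, (fromBlocks_toBlocks M).symm⟩
    let j₀ : Fin k := ⟨0, hk⟩
    obtain ⟨x, y, hxy⟩ : ∃ (x : A) (y : Matrix Unit (Fin k) A), x * a () () + (y * c) () () = 1 := by
      have h := Matrix.adjugate_mul (fromBlocks a r c P)
      rw [hM, one_smul] at h
      have h' := congrFun (congrFun h (Sum.inl ())) (Sum.inl ())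
      simp only [Matrix.mul_apply, Fintype.sum_sum_type, one_apply_eq] at h'
      exact ⟨_, Matrix.of fun _ j => adjugate (fromBlocks a r c P) (Sum.inl ()) (Sum.inr j),
        by simpa [Matrix.mul_apply] using h'⟩
    obtain ⟨f, u, hu⟩ := hA (a () ()) ((y * c) () ()) ⟨x, 1, by rw [one_mul]; exact hxy⟩
    let e₀ : Matrix (Fin k) Unit A := Matrix.single j₀ () 1
    refine of_upper_mul (f • y) (of_lower_mul (((u⁻¹ : Aˣ) : A) • (e₀ - c))
      (of_upper_mul (Matrix.single () j₀ (1 - (u : A))) ?_))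
    have hdet : (fromBlocks 1 (Matrix.single () j₀ (1 - (u : A))) 0 1 *
      (fromBlocks 1 0 (((u⁻¹ : Aˣ) : A) • (e₀ - c)) 1 *
        (fromBlocks 1 (f • y) 0 1 * fromBlocks a r c P))).det = 1 := by
      simp [hM]
    have h1 : a + f • (y * c) = (u : A) • (1 : Matrix Unit Unit A) := by
      ext; simp [hu]
    have h2 : (((u⁻¹ : Aˣ) : A) • (e₀ - c)) * (u : A) • (1 : Matrix Unit Unit A) = e₀ - c := by
      simp [smul_smul]
    have h3 : (u : A) • (1 : Matrix Unit Unit A) + Matrix.single () j₀ (1 - (u : A)) * e₀ = 1 := by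
      ext; simp [e₀]
    simp only [fromBlocks_multiply, Matrix.one_mul, Matrix.zero_mul, zero_add, add_zero,
      Matrix.smul_mul f, h1, h2, sub_add_cancel, h3] at hdet ⊢
    exact of_corner_one ih _ _ _ hdet

end Matrix.IsPolyContractible

/-- If the units are dense then the ring of complex functions has stable rank one. -/
theorem ContinuousMap.exists_isUnit_add_mul {X : Type*} [TopologicalSpace X] [CompactSpace X]
    (hX : Dense {f : C(X, ℂ) | IsUnit f}) (a b : C(X, ℂ)) (hab : IsCoprime a b) :
    ∃ f, IsUnit (a + f * b) := by
  obtain ⟨x, y, hxy⟩ := hab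
  have hopen : IsOpen {z : C(X, ℂ) | IsUnit (z * a + y * b)} :=
    Units.isOpen.preimage (f := fun z : C(X, ℂ) => z * a + y * b) (by fun_prop)
  obtain ⟨z, hz, u, rfl⟩ := hX.inter_open_nonempty _ hopen ⟨x, by simp [hxy]⟩
  refine ⟨↑u⁻¹ * y, ?_⟩
  have : a + ↑u⁻¹ * y * b = ↑u⁻¹ * (u * a + y * b) := by
    rw [mul_add, ← mul_assoc, u.inv_mul, one_mul, mul_assoc]
  rw [this]
  exact (Units.isUnit _).mul hz

theorem AddCircle.dense_isUnit_continuousMap :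
    Dense {f : C(AddCircle (1 : ℝ), ℂ) | IsUnit f} := by
  have hspan := Submodule.dense_iff_topologicalClosure_eq_top.2
    (span_fourier_closure_eq_top (T := 1))
  rw [← dense_closure]
  refine hspan.mono fun f hf => ?_
  have hsmooth : ContDiff ℝ 1 fun t : ℝ => f (t : AddCircle (1 : ℝ)) := by
    induction hf using Submodule.span_induction with
    | mem g hg =>
      obtain ⟨n, rfl⟩ := hg
      simp only [fourier_coe_apply]
      have : ContDiff ℝ 1 fun t : ℝ => (t : ℂ) := Complex.ofRealCLM.contDiff
      fun_prop
    | zero => exact contDiff_const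
    | add g h _ _ hg hh => exact hg.add hh
    | smul c g _ hg => exact contDiff_const.smul hg
  have hd := hsmooth.dense_compl_range_of_finrank_lt_finrank (by simp)
  have hcont : Continuous fun z : ℂ => f - ContinuousMap.const (AddCircle (1 : ℝ)) z := by
    fun_prop
  have h0 := hcont.range_subset_closure_image_dense hd
    (show f ∈ _ from ⟨0, by ext; simp⟩)
  refine closure_mono ?_ h0
  rintro _ ⟨z, hz, rfl⟩
  refine ContinuousMap.isUnit_iff_forall_ne_zero _ |>.2 fun x hx => hz ?_
  obtain ⟨t, rfl⟩ := QuotientAddGroup.mk_surjective x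
  exact ⟨t, sub_eq_zero.1 hx⟩

theorem ContinuousMap.dense_isUnit_of_unique {X : Type*} [TopologicalSpace X] [CompactSpace X]
    [Unique X] : Dense {f : C(X, ℂ) | IsUnit f} := by
  have hcont : Continuous fun z : ℂ => ContinuousMap.const X z := by fun_prop
  intro f
  have h0 := hcont.range_subset_closure_image_dense (dense_compl_singleton (0 : ℂ))
    (show f ∈ _ from ⟨f default, by ext x; simp [Unique.eq_default x]⟩)
  refine closure_mono ?_ h0
  rintro _ ⟨z, hz, rfl⟩
  exact ContinuousMap.isUnit_iff_forall_ne_zero _ |>.2 fun x hx => hz hx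

open scoped Matrix.Norms.L2Operator MatrixOrder in
/-- The retraction of the general linear group onto the unitary group given by the polar
decomposition. -/
theorem Matrix.exists_continuous_unitary_retraction {m Y : Type*} [Fintype m] [DecidableEq m]
    [TopologicalSpace Y] (G : Y → Matrix m m ℂ) (hG : Continuous G) (hdet : ∀ y, (G y).det = 1) :
    ∃ K : Y → Matrix.unitaryGroup m ℂ, Continuous K ∧
      ∀ y, G y ∈ Matrix.unitaryGroup m ℂ → (K y : Matrix m m ℂ) = G y := by
  have hpos (y : Y) : IsStrictlyPositive (star (G y) * G y) := by
    have hu : IsUnit (G y) := (Matrix.isUnit_iff_isUnit_det _).2 (by rw [hdet]; exact isUnit_one)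
    exact (hu.star.mul hu).isStrictlyPositive (star_mul_self_nonneg _)
  let P : Y → Matrix m m ℂ := fun y => (star (G y) * G y) ^ (-(1 / 2) : ℝ)
  have hP : Continuous P :=
    (CFC.continuousOn_rpow (-(1 / 2) : ℝ)).comp_continuous (by fun_prop) hpos
  have hPstar (y) : star (P y) = P y := (CFC.rpow_nonneg (a := star (G y) * G y)).isSelfAdjoint
  have hmem (y) : G y * P y ∈ Matrix.unitaryGroup m ℂ := by
    rw [Matrix.mem_unitaryGroup_iff', star_mul, hPstar]
    have hS : star (G y) * G y = (star (G y) * G y) ^ (1 : ℝ) :=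
      (CFC.rpow_one _ (hpos y).nonneg).symm
    calc P y * star (G y) * (G y * P y) = P y * (star (G y) * G y) * P y := by
          simp only [Matrix.mul_assoc]
      _ = 1 := by
          conv_lhs => enter [1, 2]; rw [hS]
          rw [← CFC.rpow_add (hpos y).isUnit, ← CFC.rpow_add (hpos y).isUnit]
          norm_num
          exact CFC.rpow_zero _ (hpos y).nonneg
  refine ⟨fun y => ⟨G y * P y, hmem y⟩, (hG.mul hP).subtype_mk _, fun y hy => ?_⟩
  have : P y = 1 := by
    simp only [P]
    rw [Matrix.mem_unitaryGroup_iff'.1 hy, CFC.one_rpow]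
  simp [this]

theorem Polynomial.continuous_eval_const_apply {X : Type*} [TopologicalSpace X]
    (p : Polynomial C(X, ℂ)) :
    Continuous fun z : unitInterval × X =>
      (p.eval (ContinuousMap.const X ((z.1 : ℝ) : ℂ))) z.2 := by
  simp only [Polynomial.eval_eq_sum_range, ContinuousMap.sum_apply, ContinuousMap.mul_apply,
    ContinuousMap.pow_apply, ContinuousMap.const_apply]
  fun_prop

/-- A family of special unitary matrices is contractible in the unitary group when the units are
dense among the complex functions on the parameter space. -/
theorem Matrix.exists_contraction_of_det_eq_one {m X : Type*} [Fintype m] [DecidableEq m]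
    [TopologicalSpace X] [CompactSpace X] (hX : Dense {f : C(X, ℂ) | IsUnit f})
    (M : X → Matrix.unitaryGroup m ℂ) (hM : Continuous M)
    (hdet : ∀ x, (M x : Matrix m m ℂ).det = 1) :
    ∃ K : unitInterval × X → Matrix.unitaryGroup m ℂ, Continuous K ∧
      (∀ x, K (0, x) = 1) ∧ ∀ x, K (1, x) = M x := by
  let N : Matrix m m C(X, ℂ) :=
    Matrix.of fun i j => ⟨fun x => (M x : Matrix m m ℂ) i j,
      (continuous_subtype_val.comp hM).matrix_elem i j⟩
  have hN (x : X) (P : Matrix m m C(X, ℂ)) :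
      (P.map (fun f => f x)).det = P.det x := by
    let φ : C(X, ℂ) →+* ℂ := (Pi.evalRingHom (fun _ : X => ℂ) x).comp ContinuousMap.coeFnRingHom
    exact (φ.map_det P).symm
  have hN1 : N.det = 1 := by
    ext x
    rw [← hN]
    exact hdet x
  obtain ⟨H, hH, hH0, hH1⟩ :=
    Matrix.IsPolyContractible.of_det_eq_one (ContinuousMap.exists_isUnit_add_mul hX) N hN1
  let G : unitInterval × X → Matrix m m ℂ := fun z =>
    (H.map (Polynomial.eval (ContinuousMap.const X ((z.1 : ℝ) : ℂ)))).map (fun f => f z.2)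
  have hG : Continuous G :=
    continuous_matrix fun i j => (H i j).continuous_eval_const_apply
  have hGdet (z) : (G z).det = 1 := by
    rw [hN]
    have := (Polynomial.evalRingHom (ContinuousMap.const X ((z.1 : ℝ) : ℂ))).map_det H
    rw [hH, map_one] at this
    exact (congrArg (fun f : C(X, ℂ) => f z.2) this).symm
  have hG0 (x : X) : G (0, x) = 1 := by
    have : ContinuousMap.const X (((0 : unitInterval) : ℝ) : ℂ) = 0 := by ext; simp
    simp only [G, this, hH0]
    ext i j
    by_cases hij : i = j <;> simp [hij, Matrix.one_apply]
  have hG1 (x : X) : G (1, x) = M x := by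
    have : ContinuousMap.const X (((1 : unitInterval) : ℝ) : ℂ) = 1 := by ext; simp
    simp only [G, this, hH1]
    rfl
  obtain ⟨K, hK, hKG⟩ := Matrix.exists_continuous_unitary_retraction G hG hGdet
  refine ⟨K, hK, fun x => Subtype.ext ?_, fun x => Subtype.ext ?_⟩
  · rw [hKG _ (by rw [hG0]; exact one_mem _), hG0]; rfl
  · rw [hKG _ (by rw [hG1]; exact (M x).2), hG1]

namespace Matrix.unitaryGroup

variable {m : Type*} [Fintype m] [DecidableEq m]

/-- The determinant of a unitary matrix as an element of the circle. -/
noncomputable def detCircle (M : Matrix.unitaryGroup m ℂ) : Circle :=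
  ⟨(M : Matrix m m ℂ).det, mem_sphere_zero_iff_norm.2
    (CStarRing.norm_of_mem_unitary (Matrix.det_of_mem_unitary M.2))⟩

theorem continuous_detCircle : Continuous (detCircle : Matrix.unitaryGroup m ℂ → Circle) :=
  (continuous_subtype_val.matrix_det).subtype_mk _

theorem coe_detCircle (M : Matrix.unitaryGroup m ℂ) :
    (detCircle M : ℂ) = (M : Matrix m m ℂ).det := rfl

theorem detCircle_mul (M N : Matrix.unitaryGroup m ℂ) :
    detCircle (M * N) = detCircle M * detCircle N :=
  Circle.ext (Matrix.det_mul _ _)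

theorem detCircle_one : detCircle (1 : Matrix.unitaryGroup m ℂ) = 1 :=
  Circle.ext Matrix.det_one

theorem detCircle_inv (M : Matrix.unitaryGroup m ℂ) : detCircle M⁻¹ = (detCircle M)⁻¹ :=
  eq_inv_of_mul_eq_one_left (by rw [← detCircle_mul, inv_mul_cancel, detCircle_one])

/-- The diagonal unitary matrix with entry `z` at `i` and ones elsewhere. -/
noncomputable def diagSingle (i : m) (z : Circle) : Matrix.unitaryGroup m ℂ :=
  ⟨Matrix.diagonal (Function.update 1 i (z : ℂ)), by
    rw [Matrix.mem_unitaryGroup_iff, Matrix.star_eq_conjTranspose, Matrix.diagonal_conjTranspose,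
      Matrix.diagonal_mul_diagonal, ← Matrix.diagonal_one]
    congr 1
    ext j
    obtain rfl | hj := eq_or_ne j i
    · simp [Complex.mul_conj, Complex.normSq_eq_norm_sq, Circle.norm_coe]
    · simp [hj]⟩

theorem continuous_diagSingle (i : m) : Continuous (diagSingle i) :=
  Continuous.subtype_mk (by fun_prop) _

theorem diagSingle_one (i : m) : diagSingle i 1 = 1 := by
  ext; simp [diagSingle]

theorem detCircle_diagSingle (i : m) (z : Circle) : detCircle (diagSingle i z) = z := by
  ext
  simp [coe_detCircle, diagSingle, Matrix.det_diagonal, Finset.prod_update_of_mem]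

/-- A loop in the unitary group whose determinant lifts to a loop is null-homotopic. -/
theorem exists_contraction_of_loop (i : m) (γ : unitInterval → Matrix.unitaryGroup m ℂ)
    (hγ : Continuous γ) (h0 : γ 0 = 1) (h1 : γ 1 = 1) (l : unitInterval → ℝ) (hl : Continuous l)
    (hlγ : ∀ t, Circle.exp (l t) = detCircle (γ t)) (hl01 : l 0 = l 1) :
    ∃ H : unitInterval × unitInterval → Matrix.unitaryGroup m ℂ, Continuous H ∧
      (∀ t, H (0, t) = 1) ∧ (∀ t, H (1, t) = γ t) ∧ (∀ s, H (s, 0) = 1) ∧ ∀ s, H (s, 1) = 1 := by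
  let D : unitInterval × unitInterval → Matrix.unitaryGroup m ℂ := fun z =>
    diagSingle i (Circle.exp (z.1 * (l z.2 - l 0)))
  have hD : Continuous D := (continuous_diagSingle i).comp (by fun_prop)
  let δ : unitInterval → Matrix.unitaryGroup m ℂ := fun t => (D (1, t))⁻¹ * γ t
  have hδ : Continuous δ := by fun_prop
  have hD0 (t) : D (0, t) = 1 := by simp [D, diagSingle_one]
  have hDl (s) : D (s, 0) = 1 := by simp [D, diagSingle_one]
  have hDr (s) : D (s, 1) = 1 := by simp [D, diagSingle_one, hl01]
  have hδ0 : δ 0 = 1 := by simp [δ, hDl, h0]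
  have hδ1 : δ 1 = 1 := by simp [δ, hDr, h1]
  have hδdet (t) : detCircle (δ t) = 1 := by
    have : Circle.exp (l 0) = 1 := by rw [hlγ, h0, detCircle_one]
    simp [δ, D, detCircle_mul, detCircle_inv, detCircle_diagSingle, ← hlγ, Circle.exp_sub, this]
  let M : AddCircle (1 : ℝ) → Matrix.unitaryGroup m ℂ :=
    AddCircle.liftIco 1 0 (fun t => δ (Set.projIcc 0 1 zero_le_one t))
  have hM : Continuous M := AddCircle.liftIco_zero_continuous (by simp [hδ0, hδ1])
    (hδ.comp continuous_projIcc).continuousOn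
  have hMdet (x) : (M x : Matrix m m ℂ).det = 1 := congrArg Subtype.val (hδdet _)
  have hMδ (t : unitInterval) : M ((t : ℝ) : AddCircle (1 : ℝ)) = δ t := by
    obtain ht | ht := t.2.2.lt_or_eq
    · simp only [M, AddCircle.liftIco_zero_coe_apply (⟨t.2.1, ht⟩ : (t : ℝ) ∈ Set.Ico 0 1),
        Set.projIcc_val]
    · have ht1 : t = 1 := Subtype.ext ht
      have : (((1 : unitInterval) : ℝ) : AddCircle (1 : ℝ)) = ((0 : ℝ) : AddCircle (1 : ℝ)) := by
        simp [AddCircle.coe_period]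
      rw [ht1, this, hδ1]
      simp only [M,
        AddCircle.liftIco_zero_coe_apply (⟨le_rfl, zero_lt_one⟩ : (0 : ℝ) ∈ Set.Ico 0 1)]
      simpa using hδ0
  obtain ⟨K, hK, hK0, hK1⟩ :=
    Matrix.exists_contraction_of_det_eq_one AddCircle.dense_isUnit_continuousMap M hM hMdet
  have hcoe : Continuous fun t : unitInterval => ((t : ℝ) : AddCircle (1 : ℝ)) :=
    (AddCircle.continuous_mk' 1).comp continuous_subtype_val
  refine ⟨fun z => D z * ((K (z.1, ((0 : ℝ) : AddCircle (1 : ℝ))))⁻¹ *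
    K (z.1, ((z.2 : ℝ) : AddCircle (1 : ℝ)))), by fun_prop, fun t => by simp [hD0, hK0],
    fun t => ?_, fun s => by simp [hDl], fun s => ?_⟩
  · have := hMδ 0
    simp only [hK1, hMδ]
    rw [Set.Icc.coe_zero] at this
    rw [this, hδ0]
    simp [δ]
  · have : ((1 : ℝ) : AddCircle (1 : ℝ)) = ((0 : ℝ) : AddCircle (1 : ℝ)) := by
      simp [AddCircle.coe_period]
    simp [hDr, this]

theorem homotopic_of_winding_eq [Nonempty m] {x y : Matrix.unitaryGroup m ℂ} (γ γ' : Path x y)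
    (l l' : unitInterval → ℝ) (hl : Continuous l) (hl' : Continuous l')
    (h : ∀ t, Circle.exp (l t) = detCircle (γ t))
    (h' : ∀ t, Circle.exp (l' t) = detCircle (γ' t)) (hw : l 1 - l 0 = l' 1 - l' 0) :
    γ.Homotopic γ' := by
  obtain ⟨H, hH, hH0, hH1, hHl, hHr⟩ := exists_contraction_of_loop (Classical.arbitrary m)
    (fun t => (γ t)⁻¹ * γ' t) (by fun_prop) (by simp) (by simp) (fun t => l' t - l t)
    (by fun_prop) (fun t => by simp [Circle.exp_sub, h, h', detCircle_mul, detCircle_inv,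
      div_eq_mul_inv, mul_comm]) (by linarith)
  refine ⟨⟨⟨⟨fun z => γ z.2 * H z, by fun_prop⟩, fun t => by simp [hH0],
    fun t => by simp [hH1]⟩, ?_⟩⟩
  rintro s t (rfl | rfl)
  · simp [hHl]
  · simp [hHr]

end Matrix.unitaryGroup

theorem Circle.exists_lift_exp (f : unitInterval → Circle) (hf : Continuous f) :
    ∃ l : unitInterval → ℝ, Continuous l ∧ ∀ t, Circle.exp (l t) = f t := by
  obtain ⟨e, he⟩ := Circle.exp_surjective (f 0)
  obtain ⟨Γ, hΓ, -⟩ := Circle.isCoveringMap_exp.exists_path_lifts ⟨f, hf⟩ e he.symm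
  exact ⟨Γ, Γ.continuous, fun t => congrFun hΓ t⟩

theorem Circle.winding_eq_of_homotopic {x y : Circle} {γ γ' : Path x y} (hγ : γ.Homotopic γ')
    (l l' : unitInterval → ℝ) (hl : Continuous l) (hl' : Continuous l')
    (h : ∀ t, Circle.exp (l t) = γ t) (h' : ∀ t, Circle.exp (l' t) = γ' t) :
    l 1 - l 0 = l' 1 - l' 0 := by
  have h0 : Circle.exp (l' 0) = Circle.exp (l 0) := by rw [h, h']; simp
  have e0 : γ.toContinuousMap 0 = Circle.exp (l 0) := (h 0).symm
  have e0' : γ'.toContinuousMap 0 = Circle.exp (l 0) := by rw [← h0]; exact (h' 0).symm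
  have key := Circle.isCoveringMap_exp.liftPath_apply_one_eq_of_homotopicRel hγ (l 0) e0 e0'
  have h1 : l = Circle.isCoveringMap_exp.liftPath γ.toContinuousMap (l 0) e0 :=
    (IsCoveringMap.eq_liftPath_iff _ _).2 ⟨hl, funext h, rfl⟩
  have h2 : (fun t => l' t + (l 0 - l' 0)) =
      Circle.isCoveringMap_exp.liftPath γ'.toContinuousMap (l 0) e0' :=
    (IsCoveringMap.eq_liftPath_iff _ _).2 ⟨by fun_prop, funext fun t => by
      simp [Circle.exp_add, Circle.exp_sub, h0, h'], by simp⟩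
  rw [← h1, ← h2] at key
  linarith

theorem isLift_coe_circle_iff (f : unitInterval → Circle) (l : unitInterval → ℝ) :
    IsLift (fun t => (f t : ℂ)) l ↔
      Continuous l ∧ ∀ t, Circle.exp (2 * Real.pi * l t) = f t := by
  refine and_congr_right fun _ => forall_congr' fun t => ?_
  rw [eq_comm, Circle.ext_iff, Circle.coe_exp]
  push_cast
  rw [mul_right_comm _ Complex.I]

theorem IsLift.exists_int_winding_sub {f f' : unitInterval → ℂ} {l l' : unitInterval → ℝ}
    (h : IsLift f l) (h' : IsLift f' l') (h0 : f 0 = f' 0) (h1 : f 1 = f' 1) :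
    ∃ k : ℤ, l 1 - l 0 = l' 1 - l' 0 + k := by
  have aux (t) (ht : f t = f' t) : ∃ k : ℤ, l t = l' t + k := by
    rw [h.2, h'.2, Complex.exp_eq_exp_iff_exists_int] at ht
    obtain ⟨k, hk⟩ := ht
    refine ⟨k, ?_⟩
    have : (2 * Real.pi * Complex.I) * (l t : ℂ) = (2 * Real.pi * Complex.I) * (l' t + k) := by
      rw [hk]; ring
    exact_mod_cast mul_left_cancel₀ Complex.two_pi_I_ne_zero this
  obtain ⟨a, ha⟩ := aux 0 h0
  obtain ⟨b, hb⟩ := aux 1 h1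
  exact ⟨b - a, by push_cast; linarith⟩

theorem IsLift.ceil_winding_eq_iff {f f' : unitInterval → ℂ} {l l' : unitInterval → ℝ}
    (h : IsLift f l) (h' : IsLift f' l') (h0 : f 0 = f' 0) (h1 : f 1 = f' 1) :
    ⌈l 1 - l 0⌉ = ⌈l' 1 - l' 0⌉ ↔ l 1 - l 0 = l' 1 - l' 0 := by
  obtain ⟨k, hk⟩ := h.exists_int_winding_sub h' h0 h1
  rw [hk, Int.ceil_add_intCast]
  simp

namespace Matrix.unitaryGroup

variable {m : Type*} [Fintype m] [DecidableEq m]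

theorem homotopic_iff_winding_eq [Nonempty m] {x y : Matrix.unitaryGroup m ℂ} (γ γ' : Path x y) :
    γ.Homotopic γ' ↔ ∀ l l' : unitInterval → ℝ,
      IsLift (fun t => (γ t : Matrix m m ℂ).det) l →
      IsLift (fun t => (γ' t : Matrix m m ℂ).det) l' → l 1 - l 0 = l' 1 - l' 0 := by
  have hpi : 2 * Real.pi ≠ 0 := Real.two_pi_pos.ne'
  simp only [← coe_detCircle, isLift_coe_circle_iff]
  constructor
  · rintro h l l' ⟨hl, hlγ⟩ ⟨hl', hlγ'⟩
    have := Circle.winding_eq_of_homotopic (h.map ⟨detCircle, continuous_detCircle⟩)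
      (fun t => 2 * Real.pi * l t) (fun t => 2 * Real.pi * l' t) (by fun_prop) (by fun_prop)
      hlγ hlγ'
    rw [← mul_sub, ← mul_sub] at this
    exact mul_left_cancel₀ hpi this
  · intro h
    obtain ⟨l, hl, hlγ⟩ := Circle.exists_lift_exp (fun t => detCircle (γ t))
      (continuous_detCircle.comp γ.continuous)
    obtain ⟨l', hl', hlγ'⟩ := Circle.exists_lift_exp (fun t => detCircle (γ' t))
      (continuous_detCircle.comp γ'.continuous)
    refine homotopic_of_winding_eq γ γ' l l' hl hl' hlγ hlγ' ?_
    have := h (fun t => l t / (2 * Real.pi)) (fun t => l' t / (2 * Real.pi))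
      ⟨by fun_prop, fun t => by rw [mul_div_cancel₀ _ hpi, hlγ]⟩
      ⟨by fun_prop, fun t => by rw [mul_div_cancel₀ _ hpi, hlγ']⟩
    simpa only [← sub_div, div_left_inj' hpi] using this

theorem exists_path_ceil_winding_eq [Nonempty m] (x y : Matrix.unitaryGroup m ℂ) (k : ℤ) :
    ∃ γ : Path x y, ∃ l : unitInterval → ℝ,
      IsLift (fun t => (γ t : Matrix m m ℂ).det) l ∧ ⌈l 1 - l 0⌉ = k := by
  have hpi : 2 * Real.pi ≠ 0 := Real.two_pi_pos.ne'
  simp only [← coe_detCircle, isLift_coe_circle_iff]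
  let i : m := Classical.arbitrary m
  obtain ⟨θ, hθ⟩ := Circle.exp_surjective (detCircle (x⁻¹ * y))
  have hdet : detCircle ((diagSingle i (Circle.exp θ))⁻¹ * (x⁻¹ * y)) = 1 := by
    rw [detCircle_mul, detCircle_inv, detCircle_diagSingle, hθ, inv_mul_cancel]
  obtain ⟨K, hK, hK0, hK1⟩ := Matrix.exists_contraction_of_det_eq_one
    (ContinuousMap.dense_isUnit_of_unique (X := Unit))
    (fun _ => (diagSingle i (Circle.exp θ))⁻¹ * (x⁻¹ * y)) continuous_const
    (fun _ => congrArg Subtype.val hdet)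
  obtain ⟨l, hl, hlK⟩ := Circle.exists_lift_exp (fun t => detCircle (x * K (t, ())))
    (continuous_detCircle.comp (by fun_prop))
  let j : ℤ := k - ⌈(l 1 - l 0 + θ) / (2 * Real.pi)⌉
  have hexp : Circle.exp (θ + j * (2 * Real.pi)) = Circle.exp θ := by
    rw [Circle.exp_add, Circle.exp_int_mul_two_pi, mul_one]
  refine ⟨⟨⟨fun t => x * (diagSingle i (Circle.exp (t * (θ + j * (2 * Real.pi)))) * K (t, ())), ?_⟩,
    ?_, ?_⟩, fun t => (l t + t * (θ + j * (2 * Real.pi))) / (2 * Real.pi), ⟨?_, fun t => ?_⟩, ?_⟩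
  · have := continuous_diagSingle i
    fun_prop
  · simp [hK0, diagSingle_one]
  · simp [hK1, hexp]
  · fun_prop
  · rw [mul_div_cancel₀ _ hpi, Circle.exp_add, hlK]
    simp only [detCircle_mul, detCircle_diagSingle, Path.coe_mk_mk]
    rw [mul_assoc, mul_comm (detCircle (K _))]
  · have : (l 1 + ((1 : unitInterval) : ℝ) * (θ + j * (2 * Real.pi))) / (2 * Real.pi) -
        (l 0 + ((0 : unitInterval) : ℝ) * (θ + j * (2 * Real.pi))) / (2 * Real.pi) =
        (l 1 - l 0 + θ) / (2 * Real.pi) + j := by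
      simp only [Set.Icc.coe_one, Set.Icc.coe_zero]
      field_simp
      ring
    rw [this, Int.ceil_add_intCast]
    simp [j]

end Matrix.unitaryGroup

namespace blockUnitary

variable {n : ℕ} (s : Setoid (Fin n))

open Classical in
/-- The finite set of elements of an equivalence class. -/
noncomputable def block (q : Quotient s) : Finset (Fin n) :=
  Finset.univ.filter fun i => Quotient.mk s i = q

variable {s} in
theorem mem_block {q : Quotient s} {i : Fin n} : i ∈ block s q ↔ Quotient.mk s i = q := by
  simp [block]

theorem isBlock_iff (B : Finset (Fin n)) : IsBlock s.r B ↔ ∃ q, B = block s q := by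
  constructor
  · rintro ⟨i, hi⟩
    refine ⟨Quotient.mk s i, Finset.ext fun j => ?_⟩
    rw [hi, mem_block, Quotient.eq]
    exact ⟨s.symm, s.symm⟩
  · rintro ⟨q, rfl⟩
    obtain ⟨i, rfl⟩ := Quotient.exists_rep q
    refine ⟨i, fun j => ?_⟩
    rw [mem_block, Quotient.eq]
    exact ⟨s.symm, s.symm⟩

instance nonempty_block (q : Quotient s) : Nonempty {i // i ∈ block s q} := by
  obtain ⟨i, rfl⟩ := Quotient.exists_rep q
  exact ⟨i, mem_block.2 rfl⟩

/-- An index set is the disjoint union of its blocks. -/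
noncomputable def sigmaBlockEquiv : (Σ q : Quotient s, {i // i ∈ block s q}) ≃ Fin n where
  toFun z := z.2.1
  invFun i := ⟨Quotient.mk s i, i, mem_block.2 rfl⟩
  left_inv := by
    rintro ⟨q, i, hi⟩
    obtain rfl := mem_block.1 hi
    rfl
  right_inv _ := rfl

open Classical in
theorem submatrix_sigmaBlockEquiv (M : Matrix (Fin n) (Fin n) ℂ)
    (hM : ∀ i j, ¬ s.r i j → M i j = 0) :
    M.submatrix (sigmaBlockEquiv s) (sigmaBlockEquiv s) =
      Matrix.blockDiagonal' fun q => M.submatrix (fun i : {i // i ∈ block s q} => i.1)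
        (fun j : {j // j ∈ block s q} => j.1) := by
  ext ⟨q, i⟩ ⟨q', j⟩
  obtain rfl | hq := eq_or_ne q q'
  · rw [Matrix.blockDiagonal'_apply_eq]; rfl
  · rw [Matrix.blockDiagonal'_apply_ne _ _ _ hq]
    refine hM _ _ fun h => hq ?_
    rw [← mem_block.1 i.2, ← mem_block.1 j.2]
    exact Quotient.sound h

/-- The diagonal blocks of a block diagonal unitary matrix. -/
noncomputable def toBlocks (M : blockUnitary s.r) (q : Quotient s) :
    Matrix.unitaryGroup {i // i ∈ block s q} ℂ :=
  ⟨M.1.submatrix (fun i => i.1) (fun j => j.1), by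
    classical
    have h := (Matrix.mem_unitaryGroup_iff).1 M.2.1
    have h' := congrArg (fun N => N.submatrix (sigmaBlockEquiv s) (sigmaBlockEquiv s)) h
    simp only [Matrix.submatrix_one_equiv, Matrix.star_eq_conjTranspose] at h'
    rw [← Matrix.submatrix_mul_equiv _ _ _ (sigmaBlockEquiv s), ← Matrix.conjTranspose_submatrix,
      submatrix_sigmaBlockEquiv s M.1 M.2.2, Matrix.blockDiagonal'_conjTranspose,
      ← Matrix.blockDiagonal'_mul, ← Matrix.blockDiagonal'_one, Matrix.blockDiagonal'_inj] at h'
    exact Matrix.mem_unitaryGroup_iff.2 (congrFun h' q)⟩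

open Classical in
/-- The block diagonal unitary matrix with given diagonal blocks. -/
noncomputable def ofBlocks (N : ∀ q : Quotient s, Matrix.unitaryGroup {i // i ∈ block s q} ℂ) :
    blockUnitary s.r :=
  ⟨(Matrix.blockDiagonal' fun q => (N q : Matrix _ _ ℂ)).submatrix
      (sigmaBlockEquiv s).symm (sigmaBlockEquiv s).symm, by
    rw [Matrix.mem_unitaryGroup_iff, Matrix.star_eq_conjTranspose, Matrix.conjTranspose_submatrix,
      Matrix.submatrix_mul_equiv, Matrix.blockDiagonal'_conjTranspose, ← Matrix.blockDiagonal'_mul]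
    have h : (fun q => (N q : Matrix {i // i ∈ block s q} {i // i ∈ block s q} ℂ) *
        (N q : Matrix {i // i ∈ block s q} {i // i ∈ block s q} ℂ).conjTranspose) = 1 :=
      funext fun q => Matrix.mem_unitaryGroup_iff.1 (N q).2
    rw [h, Matrix.blockDiagonal'_one, Matrix.submatrix_one_equiv],
  fun i j hij => by
    rw [Matrix.submatrix_apply]
    exact Matrix.blockDiagonal'_apply_ne _ _ _ fun h => hij (Quotient.exact h)⟩

theorem ofBlocks_toBlocks (M : blockUnitary s.r) : ofBlocks s (toBlocks s M) = M := by
  classical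
  refine Subtype.ext ?_
  have h := submatrix_sigmaBlockEquiv s M.1 M.2.2
  have h' := congrArg (fun N => N.submatrix (sigmaBlockEquiv s).symm (sigmaBlockEquiv s).symm) h
  simp only [Matrix.submatrix_submatrix, Equiv.self_comp_symm, Matrix.submatrix_id_id] at h'
  rw [h']
  simp only [ofBlocks, toBlocks]

theorem toBlocks_ofBlocks (N : ∀ q : Quotient s, Matrix.unitaryGroup {i // i ∈ block s q} ℂ) :
    toBlocks s (ofBlocks s N) = N := by
  classical
  refine funext fun q => Subtype.ext ?_
  have h := submatrix_sigmaBlockEquiv s (ofBlocks s N).1 (ofBlocks s N).2.2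
  simp only [ofBlocks, Matrix.submatrix_submatrix, Equiv.symm_comp_self,
    Matrix.submatrix_id_id] at h
  exact (congrFun (Matrix.blockDiagonal'_injective h) q).symm

/-- A block diagonal unitary matrix is a family of unitary blocks. -/
noncomputable def blocksHomeomorph :
    blockUnitary s.r ≃ₜ ∀ q : Quotient s, Matrix.unitaryGroup {i // i ∈ block s q} ℂ where
  toFun := toBlocks s
  invFun := ofBlocks s
  left_inv := ofBlocks_toBlocks s
  right_inv := toBlocks_ofBlocks s
  continuous_toFun := continuous_pi fun q =>
    Continuous.subtype_mk (continuous_subtype_val.matrix_submatrix _ _) _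
  continuous_invFun := by
    classical
    exact Continuous.subtype_mk ((Continuous.matrix_blockDiagonal' (continuous_pi fun q =>
      continuous_subtype_val.comp (continuous_apply q))).matrix_submatrix _ _) _

theorem blockDet_block (q : Quotient s) (M : blockUnitary s.r) :
    blockDet (block s q) (M : Matrix (Fin n) (Fin n) ℂ) =
      (blocksHomeomorph s M q).1.det := rfl

theorem exists_const_lift (q : Quotient s) (M : blockUnitary s.r) :
    ∃ c : ℝ, IsLift (fun _ => blockDet (block s q) (M : Matrix (Fin n) (Fin n) ℂ)) fun _ => c := by
  obtain ⟨θ, hθ⟩ := Circle.exp_surjective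
    (Matrix.unitaryGroup.detCircle (blocksHomeomorph s M q))
  exact ⟨θ / (2 * Real.pi), (isLift_coe_circle_iff (fun _ => _) _).2
    ⟨continuous_const, fun _ => by rw [mul_div_cancel₀ _ Real.two_pi_pos.ne', hθ]⟩⟩

theorem homotopic_iff {x y : blockUnitary s.r} (γ γ' : Path x y) :
    γ.Homotopic γ' ↔ ∀ q, ∀ l l' : unitInterval → ℝ,
      IsLift (fun t => blockDet (block s q) (γ t : Matrix (Fin n) (Fin n) ℂ)) l →
      IsLift (fun t => blockDet (block s q) (γ' t : Matrix (Fin n) (Fin n) ℂ)) l' →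
      l 1 - l 0 = l' 1 - l' 0 := by
  have hc (q : Quotient s) : Continuous fun M => blocksHomeomorph s M q :=
    (continuous_apply q).comp (blocksHomeomorph s).continuous
  have key : (∀ q, (γ.map (hc q)).Homotopic (γ'.map (hc q))) ↔ γ.Homotopic γ' := by
    refine ⟨fun h => ?_, fun h q => h.map ⟨_, hc q⟩⟩
    let F q := (h q).some
    refine ⟨⟨⟨⟨fun z => (blocksHomeomorph s).symm fun q => F q z, ?_⟩,
      fun t => ?_, fun t => ?_⟩, ?_⟩⟩
    · exact (blocksHomeomorph s).symm.continuous.comp (continuous_pi fun q => (F q).continuous)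
    · simp
    · simp
    · intro a t ht
      simp only [ContinuousMap.coe_mk]
      rw [Homeomorph.symm_apply_eq]
      exact funext fun q => (F q).eq_fst a ht
  rw [← key]
  exact forall_congr' fun q => Matrix.unitaryGroup.homotopic_iff_winding_eq _ _

theorem exists_path (x y : blockUnitary s.r) (k : Quotient s → ℤ) :
    ∃ γ : Path x y, ∀ q, ∃ l : unitInterval → ℝ,
      IsLift (fun t => blockDet (block s q) (γ t : Matrix (Fin n) (Fin n) ℂ)) l ∧
      ⌈l 1 - l 0⌉ = k q := by
  choose γ l hl hk using fun q => Matrix.unitaryGroup.exists_path_ceil_winding_eq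
    (blocksHomeomorph s x q) (blocksHomeomorph s y q) (k q)
  refine ⟨((Path.pi γ).map (blocksHomeomorph s).symm.continuous).cast (by simp) (by simp),
    fun q => ⟨l q, ?_, hk q⟩⟩
  simpa [blockDet_block] using hl q

end blockUnitary

/-- for a partition `𝒫` of `{1,…,n}` (given by an equivalence relation `r`)
and `x, y ∈ U(𝒫)`, the tuple of upper winding numbers `(uwn_B)_{B block of 𝒫}` induces a
well-defined bijection between homotopy classes (rel endpoints) of paths from `x` to `y`
within `U(𝒫)` and `ℤ^𝒫`; in particular a loop in `U(𝒫)` is null-homotopic in `U(𝒫)` iff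
all its winding numbers `w_B` vanish. -/
theorem paths_in_blockUnitary_classified {n : ℕ} (r : Fin n → Fin n → Prop)
    (hr : Equivalence r) (x y : ↥(blockUnitary r)) :
    (∀ γ γ' : Path x y,
      (γ.Homotopic γ' ↔
        ∀ B : Finset (Fin n), IsBlock r B →
          ∀ l l' : unitInterval → ℝ,
            IsLift (fun t => blockDet B ((γ t : ↥(blockUnitary r)) : Matrix (Fin n) (Fin n) ℂ)) l →
            IsLift (fun t => blockDet B ((γ' t : ↥(blockUnitary r)) : Matrix (Fin n) (Fin n) ℂ)) l' →
            ⌈l 1 - l 0⌉ = ⌈l' 1 - l' 0⌉)) ∧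
    (∀ m : Finset (Fin n) → ℤ, ∃ γ : Path x y,
      ∀ B : Finset (Fin n), IsBlock r B →
        ∃ l : unitInterval → ℝ,
          IsLift (fun t => blockDet B ((γ t : ↥(blockUnitary r)) : Matrix (Fin n) (Fin n) ℂ)) l ∧
          ⌈l 1 - l 0⌉ = m B) ∧
    (∀ γ : Path x x,
      (γ.Homotopic (Path.refl x) ↔
        ∀ B : Finset (Fin n), IsBlock r B →
          ∀ l : unitInterval → ℝ,
            IsLift (fun t => blockDet B ((γ t : ↥(blockUnitary r)) : Matrix (Fin n) (Fin n) ℂ)) l →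
            l 1 - l 0 = 0)) := by
  let s : Setoid (Fin n) := ⟨r, hr⟩
  have hblock {p : Finset (Fin n) → Prop} :
      (∀ B, IsBlock r B → p B) ↔ ∀ q, p (blockUnitary.block s q) :=
    ⟨fun h q => h _ ((blockUnitary.isBlock_iff s _).2 ⟨q, rfl⟩), fun h B hB => by
      obtain ⟨q, rfl⟩ := (blockUnitary.isBlock_iff s B).1 hB
      exact h q⟩
  refine ⟨fun γ γ' => ?_, fun m => ?_, fun γ => ?_⟩
  · rw [hblock, blockUnitary.homotopic_iff s γ γ']
    refine forall_congr' fun q => forall₂_congr fun l l' => forall₂_congr fun hl hl' => ?_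
    exact (hl.ceil_winding_eq_iff hl' (by simp) (by simp)).symm
  · obtain ⟨γ, hγ⟩ := blockUnitary.exists_path s x y fun q => m (blockUnitary.block s q)
    exact ⟨γ, hblock.2 hγ⟩
  · rw [hblock, blockUnitary.homotopic_iff s γ (Path.refl x)]
    refine forall_congr' fun q => ⟨fun h l hl => ?_, fun h l l' hl hl' => ?_⟩
    · obtain ⟨c, hc⟩ := blockUnitary.exists_const_lift s q x
      rw [h l _ hl hc, sub_self]
    · rw [h l hl, (blockUnitary.homotopic_iff s _ _).1 (Path.Homotopic.refl (Path.refl x)) q l' _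
        hl' (blockUnitary.exists_const_lift s q x).choose_spec, sub_self]
end

section
/- Fix n ≥ 1 and 0 ≤ k ≤ n! − 1. If there exists a weakly admissible continuous map u : Δ^{S_n}_{(k)} → U(n), then there exists an admissible continuous map u' : Δ^{S_n}_{(k)} → U(n). -/
/-- The permutation matrix `U_g`, with `U_g e_i = e_{g i}`. -/
def permMat {n : ℕ} (g : Equiv.Perm (Fin n)) : Matrix (Fin n) (Fin n) ℂ :=
  Matrix.of fun i j => if i = g j then 1 else 0

/-- `i` and `j` lie in the same orbit of the subgroup `G` of `S_n`. -/
def sameOrbit {n : ℕ} (G : Subgroup (Equiv.Perm (Fin n))) (i j : Fin n) : Prop :=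
  ∃ p ∈ G, p i = j

/-- The subgroup of `S_n` generated by the differences `g⁻¹ * h` of elements of `S`;
for `S = {g₀, …, g_l}` it is the subgroup generated by `g₀⁻¹g₁, …, g₀⁻¹g_l`. -/
def groupOf {n : ℕ} (S : Finset (Equiv.Perm (Fin n))) : Subgroup (Equiv.Perm (Fin n)) :=
  Subgroup.closure {q | ∃ g ∈ S, ∃ h ∈ S, q = g⁻¹ * h}

/-- The `k`-skeleton `Δ^{S_n}_{(k)}` of the simplex with vertices indexed by `S_n`:
points of the simplex with at most `k+1` nonzero coordinates. -/
def skel (n k : ℕ) : Set (Equiv.Perm (Fin n) → ℝ) :=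
  {x | (∀ g, 0 ≤ x g) ∧ (∑ g, x g) = 1 ∧
    (Finset.univ.filter fun g => x g ≠ 0).card ≤ k + 1}

/-- The vertex of the simplex corresponding to `g ∈ S_n`. -/
def vertex {n : ℕ} (g : Equiv.Perm (Fin n)) : Equiv.Perm (Fin n) → ℝ :=
  fun h => if h = g then 1 else 0

/-- A weakly admissible map on the `k`-skeleton: a continuous map `u` into `U(n)` such
that for every subsimplex `Δ^{g₀,…,g_l}` (support finset `S`, `l ≤ k`) and every point `x`
of it, `u x` lies in the coset `U_g · U(𝒫(Δ^{g₀,…,g_l}))` for `g ∈ S`; equivalently the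
matrix `U_g⁻¹ · u x`, whose `(i,j)` entry is `u x (g i) j`, is block diagonal for the
orbit partition of the subgroup generated by the `g₀⁻¹gᵢ`. -/
def WeaklyAdmissible (n k : ℕ)
    (u : (Equiv.Perm (Fin n) → ℝ) → Matrix (Fin n) (Fin n) ℂ) : Prop :=
  ContinuousOn u (skel n k) ∧
  (∀ x ∈ skel n k, u x ∈ Matrix.unitaryGroup (Fin n) ℂ) ∧
  ∀ S : Finset (Equiv.Perm (Fin n)), S.Nonempty → S.card ≤ k + 1 →
    ∀ x ∈ skel n k, (∀ g ∉ S, x g = 0) →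
      ∀ g ∈ S, ∀ i j : Fin n, ¬ sameOrbit (groupOf S) i j → u x (g i) j = 0

/-- An admissible map on the `k`-skeleton: weakly admissible and sending every vertex `g`
to the permutation matrix `U_g`. -/
def Admissible (n k : ℕ)
    (u : (Equiv.Perm (Fin n) → ℝ) → Matrix (Fin n) (Fin n) ℂ) : Prop :=
  WeaklyAdmissible n k u ∧ ∀ g : Equiv.Perm (Fin n), u (vertex g) = permMat g

/-- The vertices of the simplex lie in every skeleton. -/
theorem vertex_mem_skel {n : ℕ} (k : ℕ) (g : Equiv.Perm (Fin n)) : vertex g ∈ skel n k := by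
  refine ⟨fun h => ?_, ?_, ?_⟩
  · unfold vertex
    split_ifs <;> norm_num
  · simp [vertex]
  · simp [vertex, Finset.filter_eq']

/-- Two points in the same orbit of the group attached to a single vertex are equal. -/
theorem eq_of_sameOrbit_groupOf_singleton {n : ℕ} {g : Equiv.Perm (Fin n)} {i j : Fin n}
    (h : sameOrbit (groupOf {g}) i j) : i = j := by
  obtain ⟨p, hp, rfl⟩ := h
  have hbot : groupOf {g} = ⊥ := by
    simp [groupOf]
  rw [hbot, Subgroup.mem_bot] at hp
  simp [hp]

/-- At a vertex `g`, a weakly admissible map vanishes off the support of `U_g`. -/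
theorem WeaklyAdmissible.apply_vertex_eq_zero {n k : ℕ}
    {u : (Equiv.Perm (Fin n) → ℝ) → Matrix (Fin n) (Fin n) ℂ} (hu : WeaklyAdmissible n k u)
    (g : Equiv.Perm (Fin n)) {a j : Fin n} (h : a ≠ g j) : u (vertex g) a j = 0 := by
  have key := hu.2.2 {g} (Finset.singleton_nonempty g) (by simp) (vertex g) (vertex_mem_skel k g)
    (fun f hf => by simpa [vertex] using hf) g (by simp) (g⁻¹ a) j
    (fun hs => h (by simp [← eq_of_sameOrbit_groupOf_singleton hs]))
  simpa using key

/-- At a vertex `g`, the entries of a weakly admissible map on the support of `U_g` have norm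
one. -/
theorem WeaklyAdmissible.norm_apply_vertex {n k : ℕ}
    {u : (Equiv.Perm (Fin n) → ℝ) → Matrix (Fin n) (Fin n) ℂ} (hu : WeaklyAdmissible n k u)
    (g : Equiv.Perm (Fin n)) (j : Fin n) : ‖u (vertex g) (g j) j‖ = 1 := by
  have hunit := Matrix.mem_unitaryGroup_iff'.1 (hu.2.1 _ (vertex_mem_skel k g))
  have hjj := congrFun (congrFun hunit j) j
  rw [Matrix.mul_apply, Finset.sum_eq_single (g j)
    (fun a _ ha => by rw [hu.apply_vertex_eq_zero g ha, mul_zero]) (by simp)] at hjj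
  have hsq := congrArg norm hjj
  simp only [Matrix.star_apply, norm_mul, norm_star, Matrix.one_apply_eq, norm_one] at hsq
  nlinarith [norm_nonneg (u (vertex g) (g j) j)]

/-- The diagonal phases `exp (-i ∑ x_g θ_{g,j})` interpolating the phases `θ` at the vertices. -/
noncomputable def phaseCorrection {n : ℕ} (θ : Equiv.Perm (Fin n) → Fin n → ℝ)
    (x : Equiv.Perm (Fin n) → ℝ) : Matrix (Fin n) (Fin n) ℂ :=
  Matrix.diagonal fun j => Complex.exp ((-∑ g, x g * θ g j : ℝ) * Complex.I)

theorem continuous_phaseCorrection {n : ℕ} (θ : Equiv.Perm (Fin n) → Fin n → ℝ) :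
    Continuous (phaseCorrection θ) := by
  unfold phaseCorrection
  refine Continuous.matrix_diagonal ?_
  fun_prop

theorem phaseCorrection_mem_unitaryGroup {n : ℕ} (θ : Equiv.Perm (Fin n) → Fin n → ℝ)
    (x : Equiv.Perm (Fin n) → ℝ) : phaseCorrection θ x ∈ Matrix.unitaryGroup (Fin n) ℂ := by
  rw [Matrix.mem_unitaryGroup_iff', phaseCorrection, Matrix.star_eq_conjTranspose,
    Matrix.diagonal_conjTranspose, Matrix.diagonal_mul_diagonal, ← Matrix.diagonal_one]
  congr 1
  funext j
  rw [Pi.star_apply, RCLike.star_def, Complex.conj_mul', Complex.norm_exp_ofReal_mul_I]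
  simp

/-- Right multiplication by diagonal phases preserves weak admissibility. -/
theorem WeaklyAdmissible.mul_phaseCorrection {n k : ℕ}
    {u : (Equiv.Perm (Fin n) → ℝ) → Matrix (Fin n) (Fin n) ℂ} (hu : WeaklyAdmissible n k u)
    (θ : Equiv.Perm (Fin n) → Fin n → ℝ) :
    WeaklyAdmissible n k fun x => u x * phaseCorrection θ x := by
  refine ⟨hu.1.mul (continuous_phaseCorrection θ).continuousOn,
    fun x hx => mul_mem (hu.2.1 x hx) (phaseCorrection_mem_unitaryGroup θ x),
    fun S hS hcard x hx hsupp g hg i j hij => ?_⟩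
  beta_reduce
  rw [phaseCorrection, Matrix.mul_diagonal, hu.2.2 S hS hcard x hx hsupp g hg i j hij, zero_mul]

/-- if there is a weakly admissible map on the `k`-skeleton of `Δ^{S_n}`,
then there is an admissible map on the `k`-skeleton. -/
theorem weaklyAdmissible_implies_admissible {n k : ℕ} (hn : 1 ≤ n)
    (hk : k ≤ Nat.factorial n - 1)
    (h : ∃ u, WeaklyAdmissible n k u) : ∃ u', Admissible n k u' := by
  obtain ⟨u, hu⟩ := h
  refine ⟨_, hu.mul_phaseCorrection fun g j => (u (vertex g) (g j) j).arg, fun g => ?_⟩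
  ext a j
  rw [phaseCorrection, Matrix.mul_diagonal, permMat, Matrix.of_apply]
  split_ifs with h
  · subst h
    have hsum : ∑ f, vertex g f * (u (vertex f) (f j) j).arg = (u (vertex g) (g j) j).arg := by
      simp [vertex]
    have hpolar := Complex.norm_mul_exp_arg_mul_I (u (vertex g) (g j) j)
    rw [hu.norm_apply_vertex, Complex.ofReal_one, one_mul] at hpolar
    rw [hsum]
    nth_rewrite 1 [← hpolar]
    rw [← Complex.exp_add]
    simp
  · rw [hu.apply_vertex_eq_zero g h, zero_mul]
end

section
/- Let g_0 < g_1 in S_n, let 𝒫 = 𝒫(g_0⁻¹g_1) be the partition of {1, …, n} into orbits of g_0⁻¹g_1, and let γ : [0,1] → U(𝒫) be any continuous path from the identity matrix to the permutation matrix U_{g_0⁻¹g_1}. Then for every block B ∈ 𝒫 the defect of det_B ∘ γ equals (1 + (−1)^{|B|})/4; explicitly, δ(det_B ∘ γ) = 1/2 if |B| is even and δ(det_B ∘ γ) = 0 if |B| is odd. -/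
open Equiv in
/-- The sign of a permutation acting as a single cycle on a nonempty finite set, restricted to
that set. -/
theorem Equiv.Perm.IsCycleOn.sign_subtypePerm_of_nonempty {α : Type*} [DecidableEq α]
    {f : Perm α} {s : Finset α} (hf : f.IsCycleOn s) (hs : s.Nonempty)
    (h : ∀ x, f x ∈ s ↔ x ∈ s) :
    Perm.sign (f.subtypePerm h) = -(-1) ^ s.card := by
  rcases hs.exists_eq_singleton_or_nontrivial with ⟨a, rfl⟩ | hnt
  · rw [Subsingleton.elim (f.subtypePerm h) 1]
    simp
  · have hc : (f.subtypePerm h).IsCycle := hf.isCycle_subtypePerm hnt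
    have hsupp : (f.subtypePerm h).support = Finset.univ := by
      ext x
      simpa [Subtype.ext_iff] using hf.apply_ne hnt x.2
    rw [hc.sign, hsupp, Finset.card_univ, Fintype.card_coe]

/-- A block of the orbit relation of `g` is a set on which `g` acts as a single cycle. -/
theorem IsBlock.isCycleOn {n : ℕ} {g : Equiv.Perm (Fin n)} {B : Finset (Fin n)}
    (hB : IsBlock (sameOrbit (Subgroup.zpowers g)) B) : g.IsCycleOn B := by
  obtain ⟨i, hi⟩ := hB
  have hmem : ∀ j, j ∈ B ↔ g.SameCycle i j := fun j => by
    rw [hi]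
    simp [sameOrbit, Subgroup.mem_zpowers_iff, Equiv.Perm.SameCycle]
  refine ⟨g.bijOn fun x => ?_, fun x hx y hy => ?_⟩
  · simp [hmem]
  exact ((hmem x).1 hx).symm.trans ((hmem y).1 hy)

theorem IsBlock.nonempty {n : ℕ} {G : Subgroup (Equiv.Perm (Fin n))} {B : Finset (Fin n)}
    (hB : IsBlock (sameOrbit G) B) : B.Nonempty := by
  obtain ⟨i, hi⟩ := hB
  exact ⟨i, (hi i).2 ⟨1, G.one_mem, rfl⟩⟩

theorem blockDet_one {n : ℕ} (B : Finset (Fin n)) : blockDet B 1 = 1 := by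
  rw [blockDet, Matrix.submatrix_one _ Subtype.val_injective, Matrix.det_one]

theorem blockDet_permMat {n : ℕ} (g : Equiv.Perm (Fin n)) (B : Finset (Fin n))
    (h : ∀ x, g x ∈ B ↔ x ∈ B) :
    blockDet B (permMat g) = (Equiv.Perm.sign (g.subtypePerm h) : ℤ) := by
  rw [blockDet, ← Matrix.det_permutation, ← Matrix.det_transpose]
  congr 1
  ext i j
  simp [permMat, PEquiv.toMatrix_apply, Equiv.toPEquiv_apply, Subtype.ext_iff, eq_comm]

/-- The quotient of the end values of a lifted path is the exponential of the winding number. -/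
theorem IsLift.exp_winding {f : unitInterval → ℂ} {l : unitInterval → ℝ} (hl : IsLift f l) :
    Complex.exp (2 * Real.pi * Complex.I * ((l 1 - l 0 : ℝ) : ℂ)) = f 1 / f 0 := by
  rw [hl.2, hl.2, ← Complex.exp_sub]
  push_cast
  ring_nf

theorem exists_int_eq_of_exp_eq_one {w : ℝ}
    (h : Complex.exp (2 * Real.pi * Complex.I * w) = 1) : ∃ m : ℤ, w = m := by
  obtain ⟨m, hm⟩ := Complex.exp_eq_one_iff.1 h
  refine ⟨m, ?_⟩
  have : (w : ℂ) = m :=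
    mul_left_cancel₀ Complex.two_pi_I_ne_zero (by rw [hm]; ring)
  exact_mod_cast this

theorem ceil_sub_eq_zero_of_exp_eq_one {w : ℝ}
    (h : Complex.exp (2 * Real.pi * Complex.I * w) = 1) : (⌈w⌉ : ℝ) - w = 0 := by
  obtain ⟨m, rfl⟩ := exists_int_eq_of_exp_eq_one h
  simp

theorem ceil_sub_eq_half_of_exp_eq_neg_one {w : ℝ}
    (h : Complex.exp (2 * Real.pi * Complex.I * w) = -1) : (⌈w⌉ : ℝ) - w = 1 / 2 := by
  have h2 : Complex.exp (2 * Real.pi * Complex.I * ((w + 1 / 2 : ℝ) : ℂ)) = 1 := by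
    have : 2 * Real.pi * Complex.I * ((w + 1 / 2 : ℝ) : ℂ)
        = 2 * Real.pi * Complex.I * w + Real.pi * Complex.I := by
      push_cast
      ring
    rw [this, Complex.exp_add, h, Complex.exp_pi_mul_I]
    norm_num
  obtain ⟨m, hm⟩ := exists_int_eq_of_exp_eq_one h2
  have hw : ⌈w⌉ = m := by
    rw [Int.ceil_eq_iff]
    constructor <;> linarith
  rw [hw]
  linarith

/-- let `g₀ < g₁` in `S_n`, let `𝒫 = 𝒫(g₀⁻¹g₁)` be the partition into orbits
of `g₀⁻¹g₁`, and let `γ` be a path in `U(𝒫)` from the identity to the permutation matrix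
`U_{g₀⁻¹g₁}`. Then for every block `B` of `𝒫` the defect `δ(det_B ∘ γ) = ⌈w⌉ - w` equals
`(1 + (-1)^{|B|})/4`: it is `1/2` if `|B|` is even and `0` if `|B|` is odd. -/
theorem defect_of_edge_path {n : ℕ} [LinearOrder (Equiv.Perm (Fin n))]
    (g0 g1 : Equiv.Perm (Fin n)) (hlt : g0 < g1)
    (γ : unitInterval → Matrix (Fin n) (Fin n) ℂ) (hγc : Continuous γ)
    (hγ : ∀ t, γ t ∈ blockUnitary (sameOrbit (Subgroup.zpowers (g0⁻¹ * g1))))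
    (h0 : γ 0 = 1) (h1 : γ 1 = permMat (g0⁻¹ * g1))
    (B : Finset (Fin n)) (hB : IsBlock (sameOrbit (Subgroup.zpowers (g0⁻¹ * g1))) B)
    (l : unitInterval → ℝ) (hl : IsLift (fun t => blockDet B (γ t)) l) :
    ((⌈l 1 - l 0⌉ : ℝ) - (l 1 - l 0) = (1 + (-1 : ℝ) ^ B.card) / 4) ∧
    (Even B.card → (⌈l 1 - l 0⌉ : ℝ) - (l 1 - l 0) = 1 / 2) ∧
    (Odd B.card → (⌈l 1 - l 0⌉ : ℝ) - (l 1 - l 0) = 0) := by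
  have hcyc := hB.isCycleOn
  have hinv : ∀ x, (g0⁻¹ * g1) x ∈ B ↔ x ∈ B := fun x => hcyc.apply_mem_iff
  have hw := hl.exp_winding
  simp only [h0, h1, blockDet_one, blockDet_permMat _ _ hinv,
    hcyc.sign_subtypePerm_of_nonempty hB.nonempty, div_one] at hw
  rcases Nat.even_or_odd B.card with he | ho
  · have hd := ceil_sub_eq_half_of_exp_eq_neg_one (w := l 1 - l 0)
      (by simpa [he.neg_one_pow] using hw)
    refine ⟨?_, fun _ => hd, fun ho => absurd he (Nat.not_even_iff_odd.2 ho)⟩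
    rw [hd, he.neg_one_pow]
    norm_num
  · have hd := ceil_sub_eq_zero_of_exp_eq_one (w := l 1 - l 0)
      (by simpa [ho.neg_one_pow] using hw)
    refine ⟨?_, fun he => absurd he (Nat.not_even_iff_odd.2 ho), fun _ => hd⟩
    rw [hd, ho.neg_one_pow]
    norm_num
end
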